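/- For every natural number n ≥ 1 and all elements u, c of a commutative ring (e.g., all real numbers), Σ_{P ∈ PF_n} c^{critic(P)} u^{lucky(P)} = c·u · Π_{i=1}^{n−1} (i + (n−i)·u + c·u). -/

import Mathlib

/-!  Parking functions and the parking algorithm. -/

/-- Parking algorithm: cars `0, 1, ..., n-1` (in Lean's 0-based indexing of `Fin n`,
representing cars `1, ..., n`) arrive in order; car `i` drives to its favorite
(1-indexed) space `p i` and parks in the first space `s ≥ p i` not occupied by an
earlier car.  `PA p i` is the space where car `i` actually parks. -/
noncomputable def PA {n : ℕ} (p : Fin n → ℕ) (i : Fin n) : ℕ :=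
  sInf {s : ℕ | p i ≤ s ∧ ∀ j : Fin n, j < i → PA p j ≠ s}
termination_by i.val
decreasing_by exact ‹_ < _›

/-- `p` is a parking function of length `n`: every favorite space is in `{1, ..., n}`
and every car ends up parked in a space `≤ n`. -/
def IsParkingFunction {n : ℕ} (p : Fin n → ℕ) : Prop :=
  (∀ i, 1 ≤ p i ∧ p i ≤ n) ∧ ∀ i, PA p i ≤ n

/-- The set (type) `PF_n` of parking functions of length `n`. -/
def ParkingFunction (n : ℕ) : Type :=
  {p : Fin n → ℕ // IsParkingFunction p}

instance {n : ℕ} : Finite (ParkingFunction n) := by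
  apply Finite.of_injective
    (fun P : ParkingFunction n => fun i => (⟨P.1 i, Nat.lt_succ_of_le (P.2.1 i).2⟩ : Fin (n+1)))
  intro P Q h
  apply Subtype.ext; funext i
  simpa [Fin.mk.injEq] using congrFun h i

noncomputable instance {n : ℕ} : Fintype (ParkingFunction n) := Fintype.ofFinite _

/-- `jumpAt p c` is the number of jumps of car `c`, i.e. `q_c - p_c`. -/
noncomputable def jumpAt {n : ℕ} (p : Fin n → ℕ) (c : Fin n) : ℕ := PA p c - p c

/-- `jump p` is the total number of jumps. -/
noncomputable def jump {n : ℕ} (p : Fin n → ℕ) : ℕ := ∑ c, jumpAt p c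

/-- `luckyCount p k` is the number of cars `c` with `jump(p : c) = k`. -/
noncomputable def luckyCount {n : ℕ} (p : Fin n → ℕ) (k : ℕ) : ℕ :=
  Set.ncard {c : Fin n | jumpAt p c = k}

/-- `lucky p` is the number of lucky cars, i.e. cars with no jumps. -/
noncomputable def lucky {n : ℕ} (p : Fin n → ℕ) : ℕ :=
  Set.ncard {c : Fin n | jumpAt p c = 0}

/-- Car `c` is critical: immediately after car `c` is parked, there is no empty space
among the spaces strictly to the right of its space `q_c` within `{1, ..., n}`. -/
def IsCritical {n : ℕ} (p : Fin n → ℕ) (c : Fin n) : Prop :=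
  ∀ s : ℕ, PA p c < s → s ≤ n → ∃ j : Fin n, j ≤ c ∧ PA p j = s

/-- `critic p` is the number of critical cars. -/
noncomputable def critic {n : ℕ} (p : Fin n → ℕ) : ℕ :=
  Set.ncard {c : Fin n | IsCritical p c}

/-!  Rooted labeled forests, encoded by their parent function. -/

/-- A parent function `par : Fin n → Option (Fin n)` (where `par v = none` means that
`v` is a root) encodes a rooted labeled forest on `n` vertices iff it has no cycles. -/
def IsForest {n : ℕ} (par : Fin n → Option (Fin n)) : Prop :=
  ∀ v : Fin n, ¬ Relation.TransGen (fun a b => par a = some b) v v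

/-- The set (type) `F_n` of rooted labeled forests on `n` vertices. -/
def Forest (n : ℕ) : Type := {par : Fin n → Option (Fin n) // IsForest par}

instance {n : ℕ} : Finite (Forest n) := Subtype.finite
noncomputable instance {n : ℕ} : Fintype (Forest n) := Fintype.ofFinite _

/-- `x` is a descendant of `v`: `v` lies on the (unique) path from the root of `x`'s
component to `x`, i.e. the ancestor chain of `x` reaches `v`. -/
def Descendant {n : ℕ} (par : Fin n → Option (Fin n)) (v x : Fin n) : Prop :=
  Relation.ReflTransGen (fun a b => par a = some b) x v

/-- `forestInvAt F v = inv(F : v)`, the number of pairs `(v, x)` with `v > x` and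
`x` a descendant of `v`. -/
noncomputable def forestInvAt {n : ℕ} (F : Forest n) (v : Fin n) : ℕ :=
  Set.ncard {x : Fin n | x < v ∧ Descendant F.1 v x}

/-- `forestInv F = inv(F)`, the total number of inversions of `F`. -/
noncomputable def forestInv {n : ℕ} (F : Forest n) : ℕ := ∑ v, forestInvAt F v

/-- `forestLeadCount F k` is the number of vertices `v` with `inv(F : v) = k`. -/
noncomputable def forestLeadCount {n : ℕ} (F : Forest n) (k : ℕ) : ℕ :=
  Set.ncard {v : Fin n | forestInvAt F v = k}

/-- `forestLead F = lead(F)`, the number of leaders of `F`. -/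
noncomputable def forestLead {n : ℕ} (F : Forest n) : ℕ :=
  Set.ncard {v : Fin n | forestInvAt F v = 0}

/-- `forestTree F = tree(F)`, the number of trees (connected components) of `F`,
i.e. the number of roots. -/
noncomputable def forestTree {n : ℕ} (F : Forest n) : ℕ :=
  Set.ncard {v : Fin n | F.1 v = none}

section Algebra

variable {A : Type*} [CommRing A]

/-- The product `(x + (n+1)u + v) (x + (n+1)u + 2v) ⋯ (x + (n+1)u + nv)`. -/
def gouldFactor (u v : A) (n : ℕ) (x : A) : A :=
  ∏ i ∈ Finset.range n, (x + (n + 1) * u + (i + 1) * v)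

/-- The Gould polynomials: `1` for `n = 0`, and `x * gouldFactor u v (n - 1) x` otherwise. -/
def gouldPoly (u v : A) : ℕ → A → A
  | 0, _ => 1
  | n + 1, x => x * gouldFactor u v n x

@[simp] theorem gouldPoly_zero (u v x : A) : gouldPoly u v 0 x = 1 := rfl

theorem map_gouldFactor {B : Type*} [CommRing B] (f : A →+* B) (u v : A) (n : ℕ) (x : A) :
    f (gouldFactor u v n x) = gouldFactor (f u) (f v) n (f x) := by
  simp [gouldFactor, map_prod]

theorem map_gouldPoly {B : Type*} [CommRing B] (f : A →+* B) (u v : A) (n : ℕ) (x : A) :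
    f (gouldPoly u v n x) = gouldPoly (f u) (f v) n (f x) := by
  cases n <;> simp [gouldPoly, map_gouldFactor]

theorem gouldFactor_add_sub (u v : A) (n : ℕ) (x : A) :
    gouldFactor u v (n + 1) (x + v) - gouldFactor u v (n + 1) x
      = (n + 1) * v * gouldFactor u v n (x + v + u) := by
  have h : gouldFactor u v n (x + v + u)
      = ∏ i ∈ Finset.range n, (x + (n + 2) * u + (i + 2) * v) :=
    Finset.prod_congr rfl fun i _ => by ring
  have h1 : gouldFactor u v (n + 1) (x + v) = (∏ i ∈ Finset.range n, (x + (n + 2) * u + (i + 2) * v))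
      * (x + (n + 2) * u + (n + 2) * v) := by
    rw [gouldFactor, Finset.prod_range_succ]
    congr 1
    · exact Finset.prod_congr rfl fun i _ => by push_cast; ring
    · push_cast; ring
  have h2 : gouldFactor u v (n + 1) x = (∏ i ∈ Finset.range n, (x + (n + 2) * u + (i + 2) * v))
      * (x + (n + 2) * u + v) := by
    rw [gouldFactor, Finset.prod_range_succ']
    congr 1
    · exact Finset.prod_congr rfl fun i _ => by push_cast; ring
    · push_cast; ring
  rw [h, h1, h2]
  ring

theorem gouldPoly_add_sub (u v : A) (n : ℕ) (x : A) :
    gouldPoly u v (n + 1) (x + v) - gouldPoly u v (n + 1) x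
      = (n + 1) * v * gouldPoly u v n (x + v + u) := by
  cases n with
  | zero => simp [gouldPoly, gouldFactor]
  | succ n =>
    simp only [gouldPoly]
    have h : gouldFactor u v n (x + v + u)
        = ∏ i ∈ Finset.range n, (x + (n + 2) * u + (i + 2) * v) :=
      Finset.prod_congr rfl fun i _ => by ring
    have h2 : gouldFactor u v (n + 1) x
        = (∏ i ∈ Finset.range n, (x + (n + 2) * u + (i + 2) * v)) * (x + (n + 2) * u + v) := by
      rw [gouldFactor, Finset.prod_range_succ']
      congr 1
      · exact Finset.prod_congr rfl fun i _ => by push_cast; ring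
      · push_cast; ring
    have h1 := gouldFactor_add_sub u v n x
    rw [sub_eq_iff_eq_add] at h1
    rw [h1, h2, h]
    push_cast
    ring

/-- The right-hand side of the convolution formula for `gouldFactor`. -/
def gouldConvolution (u v : A) (n : ℕ) (x : A) : A :=
  ∑ k ∈ Finset.range (n + 1), (n.choose k : A) * gouldFactor u v k 0 * gouldPoly u v (n - k) x

theorem map_gouldConvolution {B : Type*} [CommRing B] (f : A →+* B) (u v : A) (n : ℕ) (x : A) :
    f (gouldConvolution u v n x) = gouldConvolution (f u) (f v) n (f x) := by
  simp [gouldConvolution, map_sum, map_gouldFactor, map_gouldPoly]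

theorem gouldConvolution_add_sub (u v : A) (n : ℕ) (x : A) :
    gouldConvolution u v (n + 1) (x + v) - gouldConvolution u v (n + 1) x
      = (n + 1) * v * gouldConvolution u v n (x + v + u) := by
  rw [gouldConvolution, gouldConvolution, ← Finset.sum_sub_distrib, Finset.sum_range_succ,
    gouldConvolution, Finset.mul_sum]
  simp only [Nat.sub_self, gouldPoly_zero, sub_self, mul_one, add_zero]
  refine Finset.sum_congr rfl fun k hk => ?_
  have hk' : k ≤ n := Nat.lt_succ_iff.mp (Finset.mem_range.mp hk)
  obtain ⟨m, rfl⟩ := Nat.exists_eq_add_of_le hk'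
  have hsub : k + m + 1 - k = m + 1 := by omega
  have hchoose : (((k + m + 1).choose k : ℕ) : A) * (m + 1)
      = (k + m + 1) * ((k + m).choose k : ℕ) := by
    have := Nat.add_one_mul_choose_eq (k + m) m
    have h1 : (k + m + 1).choose k = (k + m + 1).choose (m + 1) := by
      rw [← Nat.choose_symm_of_eq_add]; omega
    have h2 : (k + m).choose k = (k + m).choose m := by
      rw [← Nat.choose_symm_of_eq_add]; omega
    rw [h1, h2]
    exact_mod_cast congrArg (Nat.cast (R := A)) this.symm
  rw [hsub, Nat.add_sub_cancel_left, ← mul_sub, gouldPoly_add_sub]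
  push_cast
  linear_combination gouldFactor u v k 0 * v * gouldPoly u v m (x + v + u) * hchoose

theorem gouldConvolution_zero (u v : A) (n : ℕ) :
    gouldConvolution u v n 0 = gouldFactor u v n 0 := by
  rw [gouldConvolution, Finset.sum_range_succ, Finset.sum_eq_zero]
  · simp [gouldPoly]
  · intro k hk
    obtain ⟨m, hm⟩ := Nat.exists_eq_add_of_lt (Finset.mem_range.mp hk)
    have : n - k = m + 1 := by omega
    simp [this, gouldPoly]

theorem gouldFactor_eq_convolution_of_ne_zero [IsDomain A] [CharZero A] (u v : A) (hv : v ≠ 0)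
    (n : ℕ) (x : A) : gouldFactor u v n x = gouldConvolution u v n x := by
  induction n generalizing x with
  | zero => simp [gouldFactor, gouldConvolution, gouldPoly]
  | succ n ih =>
    have hmul : ∀ j : ℕ, gouldFactor u v (n + 1) (j * v) = gouldConvolution u v (n + 1) (j * v) := by
      intro j
      induction j with
      | zero => simp [gouldConvolution_zero]
      | succ j ihj =>
        have h1 := gouldFactor_add_sub u v n (j * v)
        have h2 := gouldConvolution_add_sub u v n (j * v)
        have h3 : ((j + 1 : ℕ) : A) * v = j * v + v := by push_cast; ring
        rw [h3]
        linear_combination h1 - h2 + ihj + (n + 1) * v * ih (j * v + v + u)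
    have heq : gouldFactor (Polynomial.C u) (Polynomial.C v) (n + 1) Polynomial.X
        = gouldConvolution (Polynomial.C u) (Polynomial.C v) (n + 1) Polynomial.X := by
      refine Polynomial.eq_of_infinite_eval_eq _ _ (Set.Infinite.mono ?_
        (Set.infinite_range_of_injective (f := fun j : ℕ => (j : A) * v) ?_))
      · rintro _ ⟨j, rfl⟩
        simp only [Set.mem_ofPred_eq, ← Polynomial.coe_evalRingHom, map_gouldFactor,
          map_gouldConvolution]
        simpa using hmul j
      · intro i j hij
        exact_mod_cast mul_right_cancel₀ hv hij
    have := congrArg (Polynomial.evalRingHom x) heq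
    simpa [map_gouldFactor, map_gouldConvolution] using this

theorem gouldFactor_eq_convolution (u v : A) (n : ℕ) (x : A) :
    gouldFactor u v n x = gouldConvolution u v n x := by
  have h := gouldFactor_eq_convolution_of_ne_zero (A := MvPolynomial (Fin 3) ℤ)
    (.X 0) (.X 1) (MvPolynomial.X_ne_zero 1) n (.X 2)
  have := congrArg (MvPolynomial.eval₂Hom (Int.castRingHom A) ![u, v, x]) h
  simpa [map_gouldFactor, map_gouldConvolution] using this

/-- The claimed generating function of parking functions by critical and lucky cars. -/
def criticLuckyProd (u c : A) (n : ℕ) : A :=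
  gouldPoly u (1 - u) n (c * u)

theorem criticLuckyProd_succ (u c : A) (n : ℕ) :
    criticLuckyProd u c (n + 1) = ∑ k ∈ Finset.range (n + 1), (n.choose k : A)
      * criticLuckyProd u 1 k * criticLuckyProd u c (n - k) * ((k + u) * c) := by
  have hone : ∀ k : ℕ, criticLuckyProd u 1 k * (k + u) = u * gouldFactor u (1 - u) k 0 := by
    rintro (_ | k)
    · simp [criticLuckyProd, gouldPoly, gouldFactor]
    · rw [criticLuckyProd, gouldPoly, gouldFactor, gouldFactor, Finset.prod_range_succ]
      have : ∏ i ∈ Finset.range k, (1 * u + ((k : A) + 1) * u + (i + 1) * (1 - u))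
          = ∏ i ∈ Finset.range k, (0 + (((k + 1 : ℕ) : A) + 1) * u + (i + 1) * (1 - u)) :=
        Finset.prod_congr rfl fun i _ => by push_cast; ring
      rw [this]
      push_cast
      ring
  rw [criticLuckyProd, gouldPoly, gouldFactor_eq_convolution, gouldConvolution, Finset.mul_sum]
  refine Finset.sum_congr rfl fun k _ => ?_
  simp only [criticLuckyProd] at hone ⊢
  linear_combination -(n.choose k : A) * gouldPoly u (1 - u) (n - k) (c * u) * c * hone k

theorem criticLuckyProd_eq (u c : A) (n : ℕ) (hn : 1 ≤ n) :
    criticLuckyProd u c n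
      = c * u * ∏ i ∈ Finset.Icc 1 (n - 1), ((i : A) + ((n - i : ℕ) : A) * u + c * u) := by
  obtain ⟨m, rfl⟩ := Nat.exists_eq_add_of_le' hn
  rw [criticLuckyProd, gouldPoly, gouldFactor, Nat.add_sub_cancel,
    ← Finset.Ico_add_one_right_eq_Icc, Finset.prod_Ico_eq_prod_range, Nat.add_sub_cancel]
  congr 1
  refine Finset.prod_congr rfl fun i hi => ?_
  have hi' := Finset.mem_range.mp hi
  rw [Nat.cast_sub (by omega)]
  push_cast
  ring

end Algebra

section Filling

variable {R : Type*} [CommRing R]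

/-- Total weight of all ways of filling the `t` spaces of `S` one after the other, where filling
space `e` when the set `O` is already occupied has weight `h O e`. -/
def fillWeight (h : Finset ℕ → ℕ → R) : ℕ → Finset ℕ → R
  | 0, _ => 1
  | t + 1, S => ∑ e ∈ S, fillWeight h t (S.erase e) * h (S.erase e) e

theorem sum_fillWeight_erase (h : Finset ℕ → ℕ → R) {S : Finset ℕ} (hS : S.Nonempty) :
    ∑ e ∈ S, fillWeight h (S.erase e).card (S.erase e) * h (S.erase e) e
      = fillWeight h S.card S := by
  obtain ⟨m, hm⟩ := Nat.exists_eq_add_of_le' hS.card_pos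
  rw [hm, fillWeight]
  refine Finset.sum_congr rfl fun e he => ?_
  rw [Finset.card_erase_of_mem he, hm, Nat.add_sub_cancel]

/-- If the weights on two disjoint sets do not influence each other, the fillings of the union
are the shuffles of the fillings of the two sets. -/
theorem fillWeight_union (h h₁ h₂ : Finset ℕ → ℕ → R) (t : ℕ) (A B : Finset ℕ)
    (hAB : Disjoint A B) (ht : A.card + B.card = t)
    (hA : ∀ A' ⊆ A, ∀ B' ⊆ B, ∀ e ∈ A, e ∉ A' → h (A' ∪ B') e = h₁ A' e)
    (hB : ∀ A' ⊆ A, ∀ B' ⊆ B, ∀ e ∈ B, e ∉ B' → h (A' ∪ B') e = h₂ B' e) :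
    fillWeight h t (A ∪ B)
      = t.choose A.card * fillWeight h₁ A.card A * fillWeight h₂ B.card B := by
  induction t generalizing A B with
  | zero =>
    have h1 : A.card = 0 := by omega
    have h2 : B.card = 0 := by omega
    simp [h1, h2, fillWeight]
  | succ t ih =>
    rw [fillWeight, Finset.sum_union hAB]
    have hsumA : ∑ e ∈ A, fillWeight h t ((A ∪ B).erase e) * h ((A ∪ B).erase e) e
        = t.choose (A.card - 1) * (∑ e ∈ A, fillWeight h₁ (A.erase e).card (A.erase e)
          * h₁ (A.erase e) e) * fillWeight h₂ B.card B := by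
      rw [Finset.mul_sum, Finset.sum_mul]
      refine Finset.sum_congr rfl fun e he => ?_
      have heB : e ∉ B := Finset.disjoint_left.mp hAB he
      have hcard := Finset.card_erase_add_one he
      have hsub : A.erase e ⊆ A := Finset.erase_subset e A
      rw [Finset.erase_union_distrib, Finset.erase_eq_of_notMem heB,
        ih (A.erase e) B (Finset.disjoint_of_subset_left hsub hAB) (by omega)
          (fun A' hA' B' hB' x hx => hA A' (hA'.trans hsub) B' hB' x (hsub hx))
          (fun A' hA' B' hB' x hx => hB A' (hA'.trans hsub) B' hB' x hx),
        hA _ hsub B subset_rfl e he (Finset.notMem_erase e A), ← hcard, Nat.add_sub_cancel]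
      ring
    have hsumB : ∑ e ∈ B, fillWeight h t ((A ∪ B).erase e) * h ((A ∪ B).erase e) e
        = t.choose A.card * fillWeight h₁ A.card A * (∑ e ∈ B,
          fillWeight h₂ (B.erase e).card (B.erase e) * h₂ (B.erase e) e) := by
      rw [Finset.mul_sum]
      refine Finset.sum_congr rfl fun e he => ?_
      have heA : e ∉ A := Finset.disjoint_right.mp hAB he
      have hcard := Finset.card_erase_add_one he
      have hsub : B.erase e ⊆ B := Finset.erase_subset e B
      rw [Finset.erase_union_distrib, Finset.erase_eq_of_notMem heA,
        ih A (B.erase e) (Finset.disjoint_of_subset_right hsub hAB) (by omega)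
          (fun A' hA' B' hB' x hx => hA A' hA' B' (hB'.trans hsub) x hx)
          (fun A' hA' B' hB' x hx => hB A' hA' B' (hB'.trans hsub) x (hsub hx)),
        hB A subset_rfl _ hsub e he (Finset.notMem_erase e B)]
      ring
    rw [hsumA, hsumB]
    rcases A.eq_empty_or_nonempty with rfl | hAne
    · have hBne : B.Nonempty := Finset.card_pos.mp (by simp at ht; omega)
      rw [sum_fillWeight_erase h₂ hBne]
      simp
    · obtain ⟨a, ha⟩ := Nat.exists_eq_add_of_le' hAne.card_pos
      rw [sum_fillWeight_erase h₁ hAne]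
      rcases B.eq_empty_or_nonempty with rfl | hBne
      · have : a = t := by simp at ht; omega
        subst this
        simp [ha]
      · rw [sum_fillWeight_erase h₂ hBne, ha, Nat.add_sub_cancel, Nat.choose_succ_succ]
        push_cast
        ring

/-- The number of spaces `a < e` such that all of `a, ..., e - 1` are in `O`. -/
def runLength (O : Finset ℕ) (e : ℕ) : ℕ :=
  ((Finset.range e).filter fun a => Finset.Ico a e ⊆ O).card

/-- Total weight of the preferences which lead a car to space `e` when the set of occupied
spaces among `1, ..., N` is `O`. -/
def stepWeight (u c : R) (N : ℕ) (O : Finset ℕ) (e : ℕ) : R :=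
  (runLength O e + u) * if Finset.Ioc e N ⊆ O then c else 1

theorem runLength_erase_Ioc (a m k : ℕ) (hk : k < m) :
    runLength ((Finset.Ioc a (a + m)).erase (a + k + 1)) (a + k + 1) = k := by
  have : (Finset.range (a + k + 1)).filter
      (fun x => Finset.Ico x (a + k + 1) ⊆ (Finset.Ioc a (a + m)).erase (a + k + 1))
      = Finset.Ioc a (a + k) := by
    ext x
    simp only [Finset.mem_filter, Finset.mem_range, Finset.mem_Ioc]
    constructor
    · rintro ⟨hx, hsub⟩
      have := hsub (Finset.mem_Ico.mpr ⟨le_refl x, hx⟩)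
      simp only [Finset.mem_erase, Finset.mem_Ioc] at this
      omega
    · rintro ⟨h1, h2⟩
      refine ⟨by omega, fun y hy => ?_⟩
      simp only [Finset.mem_erase, Finset.mem_Ioc, Finset.mem_Ico] at hy ⊢
      omega
  simp [runLength, this]

theorem runLength_union_left {A B : Finset ℕ} {e : ℕ} (hB : ∀ b ∈ B, e ≤ b) :
    runLength (A ∪ B) e = runLength A e := by
  unfold runLength
  congr 1
  refine Finset.filter_congr fun x _ => ⟨fun h y hy => ?_, fun h => h.trans Finset.subset_union_left⟩
  rcases Finset.mem_union.mp (h hy) with h' | h'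
  · exact h'
  · have := hB y h'
    have := (Finset.mem_Ico.mp hy).2
    omega

theorem runLength_union_right {A B : Finset ℕ} {g e : ℕ} (hge : g < e) (hA : ∀ a ∈ A, a < g)
    (hgB : g ∉ B) : runLength (A ∪ B) e = runLength B e := by
  unfold runLength
  congr 1
  refine Finset.filter_congr fun x _ =>
    ⟨fun h y hy => ?_, fun h => h.trans Finset.subset_union_right⟩
  rcases Finset.mem_union.mp (h hy) with h' | h'
  · have hy' := Finset.mem_Ico.mp hy
    have hyg := hA y h'
    rcases Finset.mem_union.mp (h (Finset.mem_Ico.mpr ⟨by omega, hge⟩)) with hg | hg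
    · exact absurd (hA g hg) (lt_irrefl g)
    · exact absurd hg hgB
  · exact h'

theorem stepWeight_union_left (u c : R) {A B : Finset ℕ} {g e N M : ℕ} (heg : e < g) (hgN : g ≤ N)
    (hA : ∀ a ∈ A, a < g) (hB : ∀ b ∈ B, g < b) :
    stepWeight u c N (A ∪ B) e = stepWeight u 1 M A e := by
  have hnot : ¬ Finset.Ioc e N ⊆ A ∪ B := fun h => by
    rcases Finset.mem_union.mp (h (Finset.mem_Ioc.mpr ⟨heg, hgN⟩)) with h' | h'
    · exact lt_irrefl _ (hA g h')
    · exact lt_irrefl _ (hB g h')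
  rw [stepWeight, stepWeight, runLength_union_left fun b hb => (heg.trans (hB b hb)).le,
    if_neg hnot, ite_self]

theorem stepWeight_union_right (u c : R) {A B : Finset ℕ} {g e N : ℕ} (hge : g < e)
    (hA : ∀ a ∈ A, a < g) (hB : ∀ b ∈ B, g < b) :
    stepWeight u c N (A ∪ B) e = stepWeight u c N B e := by
  have hiff : Finset.Ioc e N ⊆ A ∪ B ↔ Finset.Ioc e N ⊆ B := by
    refine ⟨fun h y hy => ?_, fun h => h.trans Finset.subset_union_right⟩
    rcases Finset.mem_union.mp (h hy) with h' | h'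
    · have := hA y h'
      have := (Finset.mem_Ioc.mp hy).1
      omega
    · exact h'
  simp only [stepWeight, runLength_union_right hge hA fun h => lt_irrefl _ (hB g h), hiff]

theorem fillWeight_Ioc (u c : R) (n a : ℕ) :
    fillWeight (stepWeight u c (a + n)) n (Finset.Ioc a (a + n)) = criticLuckyProd u c n := by
  induction n using Nat.strong_induction_on generalizing a c with
  | _ n ih =>
    cases n with
    | zero => simp [fillWeight, criticLuckyProd]
    | succ n =>
      have himage : Finset.Ioc a (a + (n + 1))
          = (Finset.range (n + 1)).image fun k => a + k + 1 := by
        ext x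
        simp only [Finset.mem_Ioc, Finset.mem_image, Finset.mem_range]
        exact ⟨fun h => ⟨x - a - 1, by omega, by omega⟩, by rintro ⟨k, hk, rfl⟩; omega⟩
      rw [fillWeight, criticLuckyProd_succ]
      conv_lhs => rw [himage]
      rw [Finset.sum_image (by intro x _ y _ h; simpa using h), ← himage]
      refine Finset.sum_congr rfl fun k hk => ?_
      have hk' := Finset.mem_range.mp hk
      have herase : (Finset.Ioc a (a + (n + 1))).erase (a + k + 1)
          = Finset.Ioc a (a + k) ∪ Finset.Ioc (a + k + 1) (a + k + 1 + (n - k)) := by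
        ext x
        simp only [Finset.mem_erase, Finset.mem_union, Finset.mem_Ioc]
        omega
      have hfill : fillWeight (stepWeight u c (a + (n + 1))) n
          ((Finset.Ioc a (a + (n + 1))).erase (a + k + 1))
          = n.choose k * criticLuckyProd u 1 k * criticLuckyProd u c (n - k) := by
        have hend : a + (n + 1) = a + k + 1 + (n - k) := by omega
        rw [herase, fillWeight_union _ (stepWeight u 1 (a + k)) (stepWeight u c (a + (n + 1)))]
        · rw [Nat.card_Ioc, Nat.card_Ioc, Nat.add_sub_cancel_left, Nat.add_sub_cancel_left,
            ih k (by omega), hend, ih (n - k) (by omega)]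
        · refine Finset.disjoint_left.mpr fun x hx hx' => ?_
          simp only [Finset.mem_Ioc] at hx hx'
          omega
        · simp only [Nat.card_Ioc]
          omega
        · intro A' hA' B' hB' e he _
          have he' := Finset.mem_Ioc.mp he
          exact stepWeight_union_left u c (g := a + k + 1) (by omega) (by omega)
            (fun x hx => by have := Finset.mem_Ioc.mp (hA' hx); omega)
            (fun x hx => (Finset.mem_Ioc.mp (hB' hx)).1)
        · intro A' hA' B' hB' e he _
          exact stepWeight_union_right u c (g := a + k + 1) (Finset.mem_Ioc.mp he).1
            (fun x hx => by have := Finset.mem_Ioc.mp (hA' hx); omega)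
            (fun x hx => (Finset.mem_Ioc.mp (hB' hx)).1)
      have hsub : Finset.Ioc (a + k + 1) (a + (n + 1))
          ⊆ (Finset.Ioc a (a + (n + 1))).erase (a + k + 1) := by
        intro x hx
        simp only [Finset.mem_erase, Finset.mem_Ioc] at hx ⊢
        omega
      rw [hfill, stepWeight, runLength_erase_Ioc a (n + 1) k hk', if_pos hsub]

end Filling

section Parking

/-- The first space at position at least `a` which is not in `O`. -/
noncomputable def nextFree (O : Finset ℕ) (a : ℕ) : ℕ :=
  sInf {s : ℕ | a ≤ s ∧ s ∉ O}

theorem nextFree_spec (O : Finset ℕ) (a : ℕ) : a ≤ nextFree O a ∧ nextFree O a ∉ O := by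
  have hne : {s : ℕ | a ≤ s ∧ s ∉ O}.Nonempty := by
    obtain ⟨s, hs⟩ := Infinite.exists_notMem_finset (O ∪ Finset.range a)
    simp only [Finset.mem_union, Finset.mem_range, not_or, not_lt] at hs
    exact ⟨s, hs.2, hs.1⟩
  exact Nat.sInf_mem hne

theorem nextFree_eq_iff {O : Finset ℕ} {a e : ℕ} (he : e ∉ O) :
    nextFree O a = e ↔ a ≤ e ∧ Finset.Ico a e ⊆ O := by
  constructor
  · rintro rfl
    refine ⟨(nextFree_spec O a).1, fun x hx => ?_⟩
    have hx' := Finset.mem_Ico.mp hx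
    by_contra hxO
    exact absurd (Nat.sInf_le (show x ∈ {s : ℕ | a ≤ s ∧ s ∉ O} from ⟨hx'.1, hxO⟩))
      (not_le.mpr hx'.2)
  · rintro ⟨hae, hsub⟩
    have hspec := nextFree_spec O a
    have hle : nextFree O a ≤ e :=
      Nat.sInf_le (show e ∈ {s : ℕ | a ≤ s ∧ s ∉ O} from ⟨hae, he⟩)
    by_contra hne
    exact hspec.2 (hsub (Finset.mem_Ico.mpr ⟨hspec.1, lt_of_le_of_ne hle hne⟩))

/-- The set of spaces occupied after all cars have parked. -/
noncomputable def occupied {t : ℕ} (p : Fin t → ℕ) : Finset ℕ :=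
  Finset.univ.image (PA p)

theorem mem_occupied {t : ℕ} {p : Fin t → ℕ} {s : ℕ} : s ∈ occupied p ↔ ∃ j, PA p j = s := by
  simp [occupied]

theorem PA_snoc_castSucc {t : ℕ} (p : Fin t → ℕ) (a : ℕ) (i : Fin t) :
    PA (Fin.snoc (α := fun _ => ℕ) p a) i.castSucc = PA p i := by
  induction i using WellFoundedLT.induction with
  | _ i ih =>
    rw [PA, PA]
    congr 1
    ext s
    simp only [Fin.snoc_castSucc, Set.mem_ofPred_eq]
    refine and_congr_right fun _ => ⟨fun h j hj => ?_, fun h j hj => ?_⟩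
    · rw [← ih j hj]
      exact h j.castSucc (Fin.castSucc_lt_castSucc_iff.mpr hj)
    · obtain ⟨j, rfl⟩ := Fin.exists_castSucc_eq.mpr (hj.trans (Fin.castSucc_lt_last i)).ne
      have hj' := Fin.castSucc_lt_castSucc_iff.mp hj
      rw [ih j hj']
      exact h j hj'

theorem PA_snoc_last {t : ℕ} (p : Fin t → ℕ) (a : ℕ) :
    PA (Fin.snoc (α := fun _ => ℕ) p a) (Fin.last t) = nextFree (occupied p) a := by
  rw [PA, nextFree]
  congr 1
  ext s
  simp only [Fin.snoc_last, Set.mem_ofPred_eq, mem_occupied, not_exists]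
  refine and_congr_right fun _ => ⟨fun h j => ?_, fun h j hj => ?_⟩
  · rw [← PA_snoc_castSucc p a j]
    exact h j.castSucc (Fin.castSucc_lt_last j)
  · obtain ⟨j, rfl⟩ := Fin.exists_castSucc_eq.mpr hj.ne
    rw [PA_snoc_castSucc]
    exact h j

theorem occupied_snoc {t : ℕ} (p : Fin t → ℕ) (a : ℕ) :
    occupied (Fin.snoc (α := fun _ => ℕ) p a)
      = insert (nextFree (occupied p) a) (occupied p) := by
  ext s
  rw [mem_occupied, Fin.exists_fin_succ', Finset.mem_insert, mem_occupied]
  simp only [PA_snoc_castSucc, PA_snoc_last]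
  tauto

theorem PA_spec {t : ℕ} (p : Fin t → ℕ) (i : Fin t) :
    p i ≤ PA p i ∧ ∀ j < i, PA p j ≠ PA p i := by
  have h := nextFree_spec ((Finset.univ.filter (· < i)).image (PA p)) (p i)
  have heq : PA p i = nextFree ((Finset.univ.filter (· < i)).image (PA p)) (p i) := by
    conv_lhs => rw [PA]
    simp [nextFree]
  rw [← heq] at h
  exact ⟨h.1, by simpa using h.2⟩

theorem PA_injective {t : ℕ} (p : Fin t → ℕ) : Function.Injective (PA p) := by
  intro i j hij
  rcases lt_trichotomy i j with h | h | h
  · exact absurd hij ((PA_spec p j).2 i h)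
  · exact h
  · exact absurd hij.symm ((PA_spec p i).2 j h)

variable {R : Type*} [CommRing R]

open Classical in
/-- Weight of a car which prefers space `a` when the occupied spaces among `1, ..., N` form the
set `O`: a factor `u` if it is lucky and a factor `c` if it is critical. -/
noncomputable def carWeight (u c : R) (N : ℕ) (O : Finset ℕ) (a : ℕ) : R :=
  (if nextFree O a = a then u else 1) * if Finset.Ioc (nextFree O a) N ⊆ O then c else 1

open Classical in
/-- Product of the weights of all cars, with `N` spaces. -/
noncomputable def parkingWeight (u c : R) (N : ℕ) {t : ℕ} (p : Fin t → ℕ) : R :=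
  ∏ i, ((if PA p i = p i then u else 1) *
    if ∀ s, PA p i < s → s ≤ N → ∃ j ≤ i, PA p j = s then c else 1)

theorem parkingWeight_snoc (u c : R) (N : ℕ) {t : ℕ} (p : Fin t → ℕ) (a : ℕ) :
    parkingWeight u c N (Fin.snoc (α := fun _ => ℕ) p a)
      = parkingWeight u c N p * carWeight u c N (occupied p) a := by
  classical
  rw [parkingWeight, Fin.prod_univ_castSucc, parkingWeight, carWeight]
  simp only [PA_snoc_castSucc, PA_snoc_last, Fin.snoc_castSucc, Fin.snoc_last]
  congr 1
  · refine Finset.prod_congr rfl fun i _ => ?_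
    congr 1
    refine if_congr (forall₃_congr fun s _ _ => ⟨?_, ?_⟩) rfl rfl
    · rintro ⟨j, hj, hs⟩
      obtain ⟨j, rfl⟩ := Fin.exists_castSucc_eq.mpr (hj.trans_lt (Fin.castSucc_lt_last i)).ne
      exact ⟨j, Fin.castSucc_le_castSucc_iff.mp hj, by rwa [PA_snoc_castSucc] at hs⟩
    · rintro ⟨j, hj, hs⟩
      exact ⟨j.castSucc, Fin.castSucc_le_castSucc_iff.mpr hj, by rwa [PA_snoc_castSucc]⟩
  · congr 1
    refine if_congr ⟨fun h s hs => ?_, fun h s hs hsN => ?_⟩ rfl rfl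
    · have hs' := Finset.mem_Ioc.mp hs
      obtain ⟨j, -, hj⟩ := h s hs'.1 hs'.2
      rw [mem_occupied]
      induction j using Fin.lastCases with
      | last =>
        rw [PA_snoc_last] at hj
        omega
      | cast j => exact ⟨j, by rwa [PA_snoc_castSucc] at hj⟩
    · obtain ⟨j, hj⟩ := mem_occupied.mp (h (Finset.mem_Ioc.mpr ⟨hs, hsN⟩))
      exact ⟨j.castSucc, Fin.le_last _, by rwa [PA_snoc_castSucc]⟩

theorem sum_carWeight (u c : R) (N : ℕ) {O : Finset ℕ} (hO : 0 ∉ O) {e : ℕ}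
    (he : e ∈ Finset.Icc 1 N) (heO : e ∉ O) :
    ∑ a : Finset.Icc 1 N, (if nextFree O a = e then carWeight u c N O a else 0)
      = stepWeight u c N O e := by
  classical
  have he' := Finset.mem_Icc.mp he
  rw [Finset.sum_coe_sort (Finset.Icc 1 N)
    (fun a => if nextFree O a = e then carWeight u c N O a else 0), ← Finset.sum_filter]
  have hfilter : (Finset.Icc 1 N).filter (fun a => nextFree O a = e)
      = insert e ((Finset.range e).filter fun a => Finset.Ico a e ⊆ O) := by
    ext a
    simp only [Finset.mem_filter, Finset.mem_insert, Finset.mem_range, nextFree_eq_iff heO,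
      Finset.mem_Icc]
    constructor
    · rintro ⟨_, hae, hsub⟩
      rcases hae.eq_or_lt with h | h
      · exact Or.inl h
      · exact Or.inr ⟨h, hsub⟩
    · rintro (rfl | ⟨hlt, hsub⟩)
      · simpa using he'
      · refine ⟨⟨Nat.pos_of_ne_zero ?_, by omega⟩, hlt.le, hsub⟩
        rintro rfl
        exact hO (hsub (Finset.mem_Ico.mpr ⟨le_rfl, hlt⟩))
  have hself : nextFree O e = e := by simp [nextFree_eq_iff heO]
  rw [hfilter, Finset.sum_insert (by simp)]
  have hsum : ∑ a ∈ (Finset.range e).filter (fun a => Finset.Ico a e ⊆ O), carWeight u c N O a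
      = ∑ a ∈ (Finset.range e).filter (fun a => Finset.Ico a e ⊆ O),
        if Finset.Ioc e N ⊆ O then c else 1 := by
    refine Finset.sum_congr rfl fun a ha => ?_
    obtain ⟨hlt, hsub⟩ := Finset.mem_filter.mp ha
    have hlt' := Finset.mem_range.mp hlt
    have : nextFree O a = e := (nextFree_eq_iff heO).mpr ⟨hlt'.le, hsub⟩
    rw [carWeight, this, if_neg hlt'.ne', one_mul]
  rw [hsum, Finset.sum_const, nsmul_eq_mul, carWeight, hself, if_pos rfl, stepWeight, runLength]
  ring

theorem sum_parkingWeight (u c : R) (N t : ℕ) (S : Finset ℕ) (hS : S ⊆ Finset.Icc 1 N)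
    (ht : S.card = t) :
    ∑ P : Fin t → Finset.Icc 1 N,
      (if occupied (fun i => (P i : ℕ)) = S then parkingWeight u c N (fun i => (P i : ℕ)) else 0)
      = fillWeight (stepWeight u c N) t S := by
  induction t generalizing S with
  | zero =>
    rw [Finset.card_eq_zero] at ht
    simp [ht, occupied, parkingWeight, fillWeight]
  | succ t ih =>
    have hsnoc : ∀ (P : Fin t → Finset.Icc 1 N) (a : Finset.Icc 1 N),
        (fun i => ((Fin.snoc (α := fun _ => Finset.Icc 1 N) P a i : Finset.Icc 1 N) : ℕ))
          = Fin.snoc (α := fun _ => ℕ) (fun i => (P i : ℕ)) (a : ℕ) := by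
      intro P a
      funext i
      induction i using Fin.lastCases <;> simp
    rw [← (Fin.snocEquiv fun _ => Finset.Icc 1 N).sum_comp, Fintype.sum_prod_type_right, fillWeight]
    simp only [Fin.snocEquiv_apply, hsnoc, occupied_snoc, parkingWeight_snoc]
    have hterm : ∀ (P : Fin t → Finset.Icc 1 N) (a : Finset.Icc 1 N),
        (if insert (nextFree (occupied fun i => (P i : ℕ)) a) (occupied fun i => (P i : ℕ)) = S then
          parkingWeight u c N (fun i => (P i : ℕ))
            * carWeight u c N (occupied fun i => (P i : ℕ)) a else 0)
        = ∑ e ∈ S, (if occupied (fun i => (P i : ℕ)) = S.erase e then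
            parkingWeight u c N (fun i => (P i : ℕ)) else 0)
            * (if nextFree (S.erase e) a = e then carWeight u c N (S.erase e) a else 0) := by
      intro P a
      set O := occupied fun i => (P i : ℕ)
      have hfree := (nextFree_spec O a).2
      split_ifs with h
      · have herase : S.erase (nextFree O a) = O := by rw [← h, Finset.erase_insert hfree]
        rw [Finset.sum_eq_single (nextFree O a)]
        · simp [herase]
        · intro e he hne
          by_cases hO : O = S.erase e
          · rw [← hO, if_neg hne.symm, mul_zero]
          · rw [if_neg hO, zero_mul]
        · intro hmem
          exact absurd (h ▸ Finset.mem_insert_self _ _) hmem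
      · refine (Finset.sum_eq_zero fun e he => ?_).symm
        by_cases hO : O = S.erase e
        · have hne : nextFree (S.erase e) a ≠ e := by
            intro hfe
            apply h
            rw [hO, hfe, Finset.insert_erase he]
          rw [if_neg hne, mul_zero]
        · rw [if_neg hO, zero_mul]
    simp only [hterm]
    rw [Finset.sum_congr rfl fun P _ => Finset.sum_comm, Finset.sum_comm]
    refine Finset.sum_congr rfl fun e he => ?_
    have hsub := (Finset.erase_subset e S).trans hS
    have h0 : 0 ∉ S.erase e := fun h => by simpa using hsub h
    simp only [← Finset.mul_sum]
    rw [← Finset.sum_mul, sum_carWeight u c N h0 (hS he) (Finset.notMem_erase e S),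
      ih (S.erase e) hsub (by rw [Finset.card_erase_of_mem he, ht, Nat.add_sub_cancel])]

theorem isParkingFunction_iff_occupied {n : ℕ} {p : Fin n → ℕ} (hp : ∀ i, p i ∈ Finset.Icc 1 n) :
    IsParkingFunction p ↔ occupied p = Finset.Icc 1 n := by
  constructor
  · intro h
    refine Finset.eq_of_subset_of_card_le (fun s hs => ?_) ?_
    · obtain ⟨j, rfl⟩ := mem_occupied.mp hs
      exact Finset.mem_Icc.mpr ⟨(h.1 j).1.trans (PA_spec p j).1, h.2 j⟩
    · rw [occupied, Finset.card_image_of_injective _ (PA_injective p)]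
      simp
  · intro h
    refine ⟨fun i => Finset.mem_Icc.mp (hp i), fun i => ?_⟩
    have : PA p i ∈ occupied p := mem_occupied.mpr ⟨i, rfl⟩
    rw [h] at this
    exact (Finset.mem_Icc.mp this).2

theorem parkingWeight_self (u c : R) {n : ℕ} (p : Fin n → ℕ) :
    parkingWeight u c n p = c ^ critic p * u ^ lucky p := by
  classical
  have hlucky : lucky p = (Finset.univ.filter fun i => PA p i = p i).card := by
    rw [lucky, ← Set.ncard_coe_finset]
    congr 1
    ext i
    have := (PA_spec p i).1
    simp only [Set.mem_ofPred_eq, jumpAt, Finset.coe_filter, Finset.mem_univ, true_and]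
    omega
  have hcritic : critic p = (Finset.univ.filter fun i => IsCritical p i).card := by
    rw [critic, ← Set.ncard_coe_finset]
    simp
  rw [parkingWeight, Finset.prod_mul_distrib, hlucky, hcritic, mul_comm]
  simp only [Finset.prod_ite, Finset.prod_const, one_pow, mul_one, IsCritical]
  congr!

end Parking

/-- `Σ_{P ∈ PF_n} c^{critic P} u^{lucky P}
  = c·u · Π_{i=1}^{n-1} (i + (n-i)·u + c·u)`. -/
theorem sum_critic_lucky_eq_prod (n : ℕ) (hn : 1 ≤ n) (R : Type*) [CommRing R] (u c : R) :
    ∑ P : ParkingFunction n, c ^ critic P.1 * u ^ lucky P.1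
      = c * u * ∏ i ∈ Finset.Icc 1 (n - 1), ((i : R) + ((n - i : ℕ) : R) * u + c * u) := by
  rw [← criticLuckyProd_eq u c n hn]
  have hfill := fillWeight_Ioc u c n 0
  have hIoc : Finset.Ioc 0 n = Finset.Icc 1 n := rfl
  rw [Nat.zero_add, hIoc, ← sum_parkingWeight u c n n _ subset_rfl (by simp)] at hfill
  rw [← hfill]
  refine Fintype.sum_of_injective
    (fun (P : ParkingFunction n) i => (⟨P.1 i, Finset.mem_Icc.mpr (P.2.1 i)⟩ : Finset.Icc 1 n))
    ?_ _ _ ?_ ?_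
  · intro P Q h
    refine Subtype.ext (funext fun i => ?_)
    exact congrArg Subtype.val (congrFun h i)
  · intro P hP
    refine if_neg fun hocc => hP ?_
    exact ⟨⟨_, (isParkingFunction_iff_occupied fun i => (P i).2).mpr hocc⟩, rfl⟩
  · intro P
    have hocc := (isParkingFunction_iff_occupied fun i => Finset.mem_Icc.mpr (P.2.1 i)).mp P.2
    exact ((if_pos hocc).trans (parkingWeight_self u c P.1)).symm
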